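/- Let 𝒯 be the isometry group of P, i.e. the set of isometries T : H → H with T♯P = P, acting componentwise on codebooks. If P satisfies a margin condition with some radius r_0 > 0, then for every optimal codebook c* ∈ 𝓜, the orbit {T(c*) : T ∈ 𝒯} is finite. -/

import Mathlib

open MeasureTheory Metric
open scoped Classical ENNReal NNReal BigOperators RealInnerProductSpace

noncomputable section

namespace Kmeans


variable {H : Type*} [NormedAddCommGroup H] [InnerProductSpace ℝ H]
  [MeasurableSpace H]

/-- Distortion of a codebook `c` with respect to the measure `P`. -/
def distortion (P : Measure H) (k : ℕ) (c : Fin k → H) : ℝ :=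
  ∫ x, (⨅ j : Fin k, ‖x - c j‖ ^ 2) ∂P

/-- The `j`-th closed Voronoi cell of the codebook `c`. -/
def voronoi (k : ℕ) (c : Fin k → H) (j : Fin k) : Set H :=
  {x : H | ∀ i : Fin k, ‖x - c j‖ ≤ ‖x - c i‖}

/-- The set `𝓜` of optimal codebooks, i.e. minimizers of the distortion. -/
def optimal (P : Measure H) (k : ℕ) : Set (Fin k → H) :=
  {c | ∀ c' : Fin k → H, distortion P k c ≤ distortion P k c'}

/-- `B`: minimal separation between two codepoints of an optimal codebook. -/
def Bsep (P : Measure H) (k : ℕ) : ℝ :=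
  sInf {r : ℝ | ∃ c ∈ optimal P k, ∃ i j : Fin k, i ≠ j ∧ r = ‖c i - c j‖}

/-- `p_min`: minimal mass of a Voronoi cell of an optimal codebook. -/
def pmin (P : Measure H) (k : ℕ) : ℝ :=
  sInf {r : ℝ | ∃ c ∈ optimal P k, ∃ j : Fin k, r = (P (voronoi k c j)).toReal}

/-- `N(c)`: the skeleton of the Voronoi diagram of `c`. -/
def Ncrit (k : ℕ) (c : Fin k → H) : Set H :=
  ⋃ (i : Fin k) (j : Fin k) (_ : i ≠ j), {x : H | ‖x - c i‖ = ‖x - c j‖}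

/-- `p(t)`: maximal mass of the `t`-neighborhood of the skeleton of an optimal codebook. -/
def pweight (P : Measure H) (k : ℕ) (t : ℝ) : ℝ :=
  sSup {r : ℝ | ∃ c ∈ optimal P k, r = (P {x : H | infDist x (Ncrit k c) ≤ t}).toReal}

/-- `P` is `M`-bounded: its support is contained in the closed ball of radius `M`. -/
def MBounded (P : Measure H) (M : ℝ) : Prop :=
  P (closedBall (0 : H) M) = 1

/-- The support of `P` contains more than `k` points. -/
def SupportMoreThan (P : Measure H) (k : ℕ) : Prop :=
  ∃ S : Finset H, k < S.card ∧ ∀ x ∈ S, ∀ ε : ℝ, 0 < ε → 0 < P (ball x ε)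

/-- The margin condition with radius `r₀`. -/
def MarginCondition (P : Measure H) (k : ℕ) (M r₀ : ℝ) : Prop :=
  0 < r₀ ∧ MBounded P M ∧
    ∀ t : ℝ, 0 ≤ t → t ≤ r₀ →
      pweight P k t ≤ Bsep P k * pmin P k * t / (128 * M ^ 2)

/-- The cells `W_j(c)` forming a partition subordinated to the Voronoi diagram. -/
def Wcell (k : ℕ) (c : Fin k → H) (j : Fin k) : Set H :=
  voronoi k c j \ ⋃ (i : Fin k) (_ : i < j), voronoi k c i

/-- `𝓜‾`: codebooks satisfying the centroid condition (stationary points). -/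
def stationary (P : Measure H) (k : ℕ) : Set (Fin k → H) :=
  {c | ∀ i : Fin k, (P (Wcell k c i)).toReal • c i = ∫ x in Wcell k c i, x ∂P}

/-- `P` is `ε`-separated. -/
def Separated (P : Measure H) (k : ℕ) (ε : ℝ) : Prop :=
  ∀ c ∈ stationary P k \ optimal P k, ∀ cs ∈ optimal P k,
    ε ≤ distortion P k c - distortion P k cs

/-- Euclidean distance between codebooks. -/
def cbDist (k : ℕ) (c c' : Fin k → H) : ℝ :=
  Real.sqrt (∑ j : Fin k, ‖c j - c' j‖ ^ 2)

/-- The empirical measure of a sample. -/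
def empMeasure {n : ℕ} (X : Fin n → H) : Measure H :=
  ((n : ℝ≥0∞))⁻¹ • ∑ i : Fin n, Measure.dirac (X i)

/-- Number of optimal codebooks up to relabeling of codepoints. -/
def MbarCard (P : Measure H) (k : ℕ) : ℕ :=
  Set.ncard {s : Set (Fin k → H) |
    ∃ c ∈ optimal P k, s = {c' | ∃ π : Equiv.Perm (Fin k), c' = c ∘ π}}

/-- The mass `p_{ij}(c,t)` of a slab along the segment `[c_i, c_j]` intersected with `V_j(c)`. -/
def pij (P : Measure H) (k : ℕ) (c : Fin k → H) (i j : Fin k) (t : ℝ) : ℝ :=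
  (P ({x : H |
      0 ≤ ⟪x - (2⁻¹ : ℝ) • (c i + c j), ‖c i - c j‖⁻¹ • (c j - c i)⟫ ∧
      ⟪x - (2⁻¹ : ℝ) • (c i + c j), ‖c i - c j‖⁻¹ • (c j - c i)⟫ ≤ t} ∩
    voronoi k c j)).toReal

/-- The classification risk between two (ordered) partitions. -/
def classifRisk (P : Measure H) (k : ℕ) (C C' : Fin k → Set H) : ℝ :=
  sInf {r : ℝ | ∃ π : Equiv.Perm (Fin k),
    r = (P (⋃ j : Fin k, C (π j) ∩ (C' j)ᶜ)).toReal}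

/-- A sample is `f`-clusterable. -/
def Clusterable {n : ℕ} (X : Fin n → H) (k : ℕ) (f : ℝ) : Prop :=
  ∃ c ∈ optimal (empMeasure X) k, ∀ i j : Fin k, i ≠ j →
    f * Real.sqrt (distortion (empMeasure X) k c) *
      (1 / Real.sqrt ((Finset.univ.filter fun a => X a ∈ voronoi k c i).card) +
       1 / Real.sqrt ((Finset.univ.filter fun a => X a ∈ voronoi k c j).card))
      ≤ ‖c i - c j‖

/-- Membership in the class `𝓓(B₋, r₀₋, p₋, ε₋)` of distributions. -/
def inClassD (P : Measure H) (k : ℕ) (M Bm rm pm em : ℝ) : Prop :=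
  IsProbabilityMeasure P ∧ SupportMoreThan P k ∧
    (∃ r₀ : ℝ, rm ≤ r₀ ∧ MarginCondition P k M r₀) ∧
    Bm ≤ Bsep P k ∧ pm ≤ pmin P k ∧ Separated P k em

end Kmeans

open Kmeans

section Codebook

variable {H : Type*} [NormedAddCommGroup H]

lemma isometry_preimage_voronoi {k : ℕ} {T : H → H} (hT : Isometry T) (c : Fin k → H)
    (j : Fin k) : T ⁻¹' voronoi k (T ∘ c) j = voronoi k c j := by
  ext x
  simp [voronoi, ← dist_eq_norm, hT.dist_eq]

lemma ciInf_norm_sub_sq_le {k : ℕ} (c : Fin k → H) (x : H) (j : Fin k) :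
    ⨅ i, ‖x - c i‖ ^ 2 ≤ ‖x - c j‖ ^ 2 :=
  ciInf_le (Set.finite_range _).bddBelow j

lemma ciInf_norm_sub_sq_eq {k : ℕ} {c : Fin k → H} {x : H} {j : Fin k}
    (hx : x ∈ voronoi k c j) : ⨅ i, ‖x - c i‖ ^ 2 = ‖x - c j‖ ^ 2 :=
  have : Nonempty (Fin k) := ⟨j⟩
  (ciInf_norm_sub_sq_le c x j).antisymm (le_ciInf fun i => by gcongr; exact hx i)

lemma exists_mem_voronoi {k : ℕ} [Nonempty (Fin k)] (c : Fin k → H) (x : H) :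
    ∃ j, x ∈ voronoi k c j :=
  Finite.exists_min fun i => ‖x - c i‖

end Codebook

section Skeleton

variable {H : Type*} [NormedAddCommGroup H] [InnerProductSpace ℝ H]

/-- The hyperplane equidistant from `a` and `b` is close to `x` when `x` is closer to `a`, but
nearly equidistant from both points. -/
lemma exists_dist_le_of_norm_sub_le {x a b : H} {D e s : ℝ} (hs : 0 < s) (hab : s ≤ ‖a - b‖)
    (ha : ‖x - a‖ ≤ D) (hb : ‖x - b‖ ≤ D) (hle : ‖x - a‖ ≤ ‖x - b‖)
    (hge : ‖x - b‖ ≤ ‖x - a‖ + e) :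
    ∃ y, ‖y - a‖ = ‖y - b‖ ∧ dist x y ≤ D * e / s := by
  have hn : 0 < ‖a - b‖ := hs.trans_le hab
  set q := ‖x - b‖ ^ 2 - ‖x - a‖ ^ 2 with hq
  have hq0 : 0 ≤ q := by nlinarith [norm_nonneg (x - a)]
  have hq1 : q ≤ 2 * D * e := by nlinarith [norm_nonneg (x - a), norm_nonneg (x - b)]
  have hinner : q = 2 * ⟪x, a - b⟫ + ‖b‖ ^ 2 - ‖a‖ ^ 2 := by
    rw [hq, norm_sub_sq_real, norm_sub_sq_real, inner_sub_right]; ring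
  refine ⟨x - (q / (2 * ‖a - b‖ ^ 2)) • (a - b), ?_, ?_⟩
  · set y := x - (q / (2 * ‖a - b‖ ^ 2)) • (a - b) with hy
    have h1 : ⟪y, a - b⟫ = ⟪x, a - b⟫ - q / 2 := by
      rw [hy, inner_sub_left, inner_smul_left, real_inner_self_eq_norm_sq]
      simp only [conj_trivial]
      field_simp
    have h2 : ‖y - b‖ ^ 2 - ‖y - a‖ ^ 2 = 2 * ⟪y, a - b⟫ + ‖b‖ ^ 2 - ‖a‖ ^ 2 := by
      rw [norm_sub_sq_real y, norm_sub_sq_real y, inner_sub_right]; ring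
    exact (sq_eq_sq₀ (norm_nonneg _) (norm_nonneg _)).1 (by linarith)
  · rw [dist_eq_norm, sub_sub_cancel, norm_smul, Real.norm_of_nonneg (by positivity)]
    have h1 : q / (2 * ‖a - b‖ ^ 2) * ‖a - b‖ = q / 2 / ‖a - b‖ := by field_simp
    rw [h1]
    gcongr
    · linarith
    · linarith

/-- A point whose nearest codepoint changes between `a` and `c` is close to the skeleton of `a`. -/
lemma infDist_Ncrit_le {k : ℕ} {a c : Fin k → H} {x : H} {D δ s : ℝ} (hs : 0 < s)
    (hsep : ∀ i j, i ≠ j → s ≤ ‖a i - a j‖) (hD : ∀ i, ‖x - a i‖ ≤ D)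
    (hδ : ∀ i, ‖a i - c i‖ ≤ δ) {j : Fin k}
    (hx : ¬ (x ∈ voronoi k a j ↔ x ∈ voronoi k c j)) :
    infDist x (Ncrit k a) ≤ D * (2 * δ) / s := by
  have h1 : ∀ i, ‖x - a i‖ ≤ ‖x - c i‖ + δ := fun i => by
    have := norm_sub_le (x - c i) (a i - c i)
    rw [sub_sub_sub_cancel_right] at this
    linarith [hδ i]
  have h2 : ∀ i, ‖x - c i‖ ≤ ‖x - a i‖ + δ := fun i => by
    have := norm_add_le (x - a i) (a i - c i)
    rw [sub_add_sub_cancel] at this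
    linarith [hδ i]
  have key : ∀ i l, i ≠ l → ‖x - a i‖ ≤ ‖x - a l‖ → ‖x - a l‖ ≤ ‖x - a i‖ + 2 * δ →
      infDist x (Ncrit k a) ≤ D * (2 * δ) / s := fun i l hil hle hge => by
    obtain ⟨y, hy, hxy⟩ := exists_dist_le_of_norm_sub_le hs (hsep i l hil) (hD i) (hD l) hle hge
    exact (infDist_le_dist_of_mem (by simp only [Ncrit, Set.mem_iUnion]; exact ⟨i, l, hil, hy⟩)).trans
      hxy
  by_cases hc : x ∈ voronoi k c j
  · have ha : x ∉ voronoi k a j := fun ha => hx ⟨fun _ => hc, fun _ => ha⟩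
    simp only [voronoi, Set.mem_ofPred_eq, not_forall, not_le] at ha hc
    obtain ⟨i, hi⟩ := ha
    exact key i j (by rintro rfl; exact hi.false) hi.le (by linarith [h1 j, h2 i, hc i])
  · have ha : x ∈ voronoi k a j := by_contra fun ha => hx ⟨fun h => (ha h).elim, fun h => (hc h).elim⟩
    simp only [voronoi, Set.mem_ofPred_eq, not_forall, not_le] at ha hc
    obtain ⟨i, hi⟩ := hc
    exact key j i (by rintro rfl; exact hi.false) (ha i) (by linarith [h1 i, h2 j])

end Skeleton

section Distortion

variable {H : Type*} [NormedAddCommGroup H] [MeasurableSpace H]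

lemma Bsep_le {P : Measure H} {k : ℕ} {c : Fin k → H} (hc : c ∈ optimal P k) {i j : Fin k}
    (hij : i ≠ j) : Bsep P k ≤ ‖c i - c j‖ :=
  csInf_le ⟨0, by rintro _ ⟨_, _, _, _, _, rfl⟩; positivity⟩ ⟨c, hc, i, j, hij, rfl⟩

lemma pmin_le {P : Measure H} {k : ℕ} {c : Fin k → H} (hc : c ∈ optimal P k) (j : Fin k) :
    pmin P k ≤ P.real (voronoi k c j) :=
  csInf_le ⟨0, by rintro _ ⟨_, _, _, rfl⟩; positivity⟩ ⟨c, hc, j, rfl⟩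

lemma pmin_nonneg (P : Measure H) (k : ℕ) : 0 ≤ pmin P k :=
  Real.sInf_nonneg (by rintro _ ⟨_, _, _, rfl⟩; positivity)

lemma le_pweight {P : Measure H} [IsProbabilityMeasure P] {k : ℕ} {c : Fin k → H}
    (hc : c ∈ optimal P k) (t : ℝ) : P.real {x | infDist x (Ncrit k c) ≤ t} ≤ pweight P k t :=
  le_csSup ⟨1, by rintro _ ⟨_, _, rfl⟩; exact measureReal_le_one⟩ ⟨c, hc, rfl⟩

variable [BorelSpace H]

lemma measurableSet_voronoi (k : ℕ) (c : Fin k → H) (j : Fin k) :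
    MeasurableSet (voronoi k c j) := by
  have : voronoi k c j = ⋂ i, {x | ‖x - c j‖ ≤ ‖x - c i‖} := by ext; simp [voronoi]
  rw [this]
  exact (isClosed_iInter fun i => isClosed_le (by fun_prop) (by fun_prop)).measurableSet

lemma Kmeans.MBounded.ae_norm_le {P : Measure H} [IsProbabilityMeasure P] {M : ℝ} (h : MBounded P M) :
    ∀ᵐ x ∂P, ‖x‖ ≤ M := by
  have : ∀ᵐ x ∂P, x ∈ closedBall (0 : H) M :=
    (mem_ae_iff_prob_eq_one isClosed_closedBall.measurableSet).2 h
  simpa using this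

lemma optimal_comp_isometry {P : Measure H} {k : ℕ} {c : Fin k → H} (hc : c ∈ optimal P k)
    {T : H → H} (hT : Isometry T) (hP : P.map T = P) : T ∘ c ∈ optimal P k := by
  intro c'
  refine le_of_eq_of_le ?_ (hc c')
  have hm : Measurable fun x : H => ⨅ j : Fin k, ‖x - (T ∘ c) j‖ ^ 2 :=
    Measurable.iInf fun j => by fun_prop
  unfold distortion
  conv_lhs => rw [← hP]
  rw [integral_map hT.continuous.measurable.aemeasurable hm.aestronglyMeasurable]
  simp [← dist_eq_norm, hT.dist_eq]

variable [SecondCountableTopology H]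

lemma integrable_norm_sub_sq {P : Measure H} [IsProbabilityMeasure P] {M : ℝ}
    (hP : MBounded P M) (a : H) : Integrable (fun x => ‖x - a‖ ^ 2) P := by
  refine Integrable.of_bound (by fun_prop) ((M + ‖a‖) ^ 2) ?_
  filter_upwards [hP.ae_norm_le] with x hx
  rw [Real.norm_of_nonneg (by positivity)]
  gcongr
  exact (norm_sub_le _ _).trans (by gcongr)

lemma integrable_id_of_MBounded {P : Measure H} [IsProbabilityMeasure P] {M : ℝ}
    (hP : MBounded P M) : Integrable (fun x : H => x) P :=
  Integrable.of_bound (by fun_prop) M hP.ae_norm_le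

lemma integrable_ciInf_norm_sub_sq {P : Measure H} [IsProbabilityMeasure P] {M : ℝ}
    (hP : MBounded P M) {k : ℕ} [Nonempty (Fin k)] (c : Fin k → H) :
    Integrable (fun x => ⨅ j, ‖x - c j‖ ^ 2) P := by
  have j : Fin k := Classical.arbitrary _
  refine (integrable_norm_sub_sq hP (c j)).mono'
    (Measurable.iInf fun j => by fun_prop).aestronglyMeasurable (.of_forall fun x => ?_)
  rw [Real.norm_of_nonneg (le_ciInf fun _ => by positivity)]
  exact ciInf_norm_sub_sq_le c x j

/-- In an optimal codebook no codepoint is redundant. -/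
lemma not_ae_exists_ne_mem_voronoi {P : Measure H} [IsProbabilityMeasure P] {M : ℝ}
    (hP : MBounded P M) {k : ℕ} (hsupp : SupportMoreThan P k) {c : Fin k → H}
    (hc : c ∈ optimal P k) (j : Fin k) : ¬ ∀ᵐ x ∂P, ∃ i ≠ j, x ∈ voronoi k c i := by
  intro hred
  have : Nonempty (Fin k) := ⟨j⟩
  obtain ⟨S, hS, hSpos⟩ := hsupp
  obtain ⟨z, hzS, hz⟩ : ∃ z ∈ S, z ∉ Finset.univ.image c :=
    Finset.exists_mem_notMem_of_card_lt_card
      ((Finset.card_image_le.trans_eq (by simp)).trans_lt hS)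
  have hz : ∀ i, 0 < ‖z - c i‖ := fun i => norm_pos_iff.2 <| sub_ne_zero.2 fun h =>
    hz (by simp [h])
  obtain ⟨l, hl⟩ := exists_mem_voronoi c z
  have hle : (fun x => ⨅ i, ‖x - Function.update c j z i‖ ^ 2) ≤ᵐ[P]
      fun x => ⨅ i, ‖x - c i‖ ^ 2 := by
    filter_upwards [hred] with x ⟨i, hij, hi⟩
    rw [ciInf_norm_sub_sq_eq hi]
    exact (ciInf_norm_sub_sq_le _ x i).trans_eq (by rw [Function.update_of_ne hij])
  have heq := (integral_eq_iff_of_ae_le (integrable_ciInf_norm_sub_sq hP _)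
    (integrable_ciInf_norm_sub_sq hP c) hle).1 ((integral_mono_ae
      (integrable_ciInf_norm_sub_sq hP _) (integrable_ciInf_norm_sub_sq hP c) hle).antisymm (hc _))
  refine (hSpos z hzS (‖z - c l‖ / 2) (half_pos (hz l))).ne' ?_
  refine measure_mono_null ?_ (mem_ae_iff.1 heq)
  intro x hx hx'
  simp only [mem_ball, dist_eq_norm] at hx
  simp only [Set.mem_ofPred_eq] at hx'
  obtain ⟨m, hm⟩ := exists_mem_voronoi c x
  have h1 := ciInf_norm_sub_sq_le (Function.update c j z) x j
  rw [hx', ciInf_norm_sub_sq_eq hm, Function.update_self] at h1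
  have h2 := (sq_le_sq₀ (norm_nonneg _) (norm_nonneg _)).1 h1
  have h3 := norm_sub_le (x - c m) (x - z)
  rw [sub_sub_sub_cancel_left] at h3
  linarith [hl m]

lemma measureReal_voronoi_pos {P : Measure H} [IsProbabilityMeasure P] {M : ℝ}
    (hP : MBounded P M) {k : ℕ} (hsupp : SupportMoreThan P k) {c : Fin k → H}
    (hc : c ∈ optimal P k) (j : Fin k) : 0 < P.real (voronoi k c j) := by
  refine ENNReal.toReal_pos (fun h0 => not_ae_exists_ne_mem_voronoi hP hsupp hc j ?_)
    (measure_ne_top _ _)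
  have : Nonempty (Fin k) := ⟨j⟩
  filter_upwards [measure_eq_zero_iff_ae_notMem.1 h0] with x hx
  obtain ⟨i, hi⟩ := exists_mem_voronoi c x
  exact ⟨i, by rintro rfl; exact hx hi, hi⟩

lemma injective_of_optimal {P : Measure H} [IsProbabilityMeasure P] {M : ℝ}
    (hP : MBounded P M) {k : ℕ} (hsupp : SupportMoreThan P k) {c : Fin k → H}
    (hc : c ∈ optimal P k) : Function.Injective c := by
  intro i j hij
  by_contra hne
  refine not_ae_exists_ne_mem_voronoi hP hsupp hc j (.of_forall fun x => ?_)
  have : Nonempty (Fin k) := ⟨j⟩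
  obtain ⟨l, hl⟩ := exists_mem_voronoi c x
  by_cases h : l = j
  · subst h
    exact ⟨i, hne, fun m => by rw [hij]; exact hl m⟩
  · exact ⟨l, h, hl⟩

variable [InnerProductSpace ℝ H] [CompleteSpace H]

/-- The centroid condition for optimal codebooks. -/
lemma measureReal_smul_eq_setIntegral_voronoi {P : Measure H} [IsProbabilityMeasure P] {M : ℝ}
    (hP : MBounded P M) {k : ℕ} (hsupp : SupportMoreThan P k) {c : Fin k → H}
    (hc : c ∈ optimal P k) (j : Fin k) :
    P.real (voronoi k c j) • c j = ∫ x in voronoi k c j, x ∂P := by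
  have : Nonempty (Fin k) := ⟨j⟩
  set V := voronoi k c j with hV
  have hVm : MeasurableSet V := measurableSet_voronoi k c j
  have hp : 0 < P.real V := measureReal_voronoi_pos hP hsupp hc j
  set m := (P.real V)⁻¹ • ∫ x in V, x ∂P with hm
  have hpm : P.real V • m = ∫ x in V, x ∂P := by rw [hm, smul_inv_smul₀ hp.ne']
  have hid := integrable_id_of_MBounded hP
  have hle : ∀ x, ⨅ i, ‖x - Function.update c j m i‖ ^ 2 ≤
      (⨅ i, ‖x - c i‖ ^ 2) +
        V.indicator (fun x => ‖x - m‖ ^ 2 - ‖x - c j‖ ^ 2) x := by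
    intro x
    by_cases hx : x ∈ V
    · rw [Set.indicator_of_mem hx, ciInf_norm_sub_sq_eq hx, add_sub_cancel]
      exact (ciInf_norm_sub_sq_le _ x j).trans_eq (by rw [Function.update_self])
    · rw [Set.indicator_of_notMem hx, add_zero]
      obtain ⟨i, hi⟩ := exists_mem_voronoi c x
      rw [ciInf_norm_sub_sq_eq hi]
      exact (ciInf_norm_sub_sq_le _ x i).trans_eq
        (by rw [Function.update_of_ne (by rintro rfl; exact hx hi)])
  have hint : Integrable (fun x => ‖x - m‖ ^ 2 - ‖x - c j‖ ^ 2) P :=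
    (integrable_norm_sub_sq hP m).sub (integrable_norm_sub_sq hP (c j))
  have h1 := (hc (Function.update c j m)).trans (integral_mono
    (integrable_ciInf_norm_sub_sq hP _)
    ((integrable_ciInf_norm_sub_sq hP c).add (hint.indicator hVm)) hle)
  simp only [Pi.add_apply] at h1
  rw [integral_add (integrable_ciInf_norm_sub_sq hP c) (hint.indicator hVm),
    integral_indicator hVm] at h1
  have h2 : ∫ x in V, (‖x - m‖ ^ 2 - ‖x - c j‖ ^ 2) ∂P = -(P.real V * ‖m - c j‖ ^ 2) := by
    have h3 : ∀ x : H, ‖x - m‖ ^ 2 - ‖x - c j‖ ^ 2 =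
        2 * ⟪c j - m, x⟫ + (‖m‖ ^ 2 - ‖c j‖ ^ 2) := fun x => by
      rw [norm_sub_sq_real, norm_sub_sq_real, inner_sub_left, real_inner_comm x (c j), real_inner_comm x m]
      ring
    simp_rw [h3]
    rw [integral_add ((hid.integrableOn.const_inner _).const_mul 2) (integrable_const _),
      integral_const_mul, integral_inner hid.integrableOn, ← hpm, inner_smul_right]
    simp only [integral_const, measureReal_restrict_apply_univ, smul_eq_mul]
    rw [inner_sub_left, real_inner_self_eq_norm_sq, norm_sub_sq_real m, real_inner_comm]
    ring
  rw [h2] at h1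
  have h4 : P.real V * ‖m - c j‖ ^ 2 ≤ 0 := by
    have : distortion P k c = ∫ x, (⨅ i, ‖x - c i‖ ^ 2) ∂P := rfl
    linarith
  have h5 : ‖m - c j‖ = 0 := by
    have : ‖m - c j‖ ^ 2 ≤ 0 := by nlinarith [sq_nonneg ‖m - c j‖]
    nlinarith [norm_nonneg (m - c j)]
  rw [← hpm, sub_eq_zero.1 (norm_eq_zero.1 h5)]

lemma norm_le_of_optimal {P : Measure H} [IsProbabilityMeasure P] {M : ℝ}
    (hP : MBounded P M) {k : ℕ} (hsupp : SupportMoreThan P k) {c : Fin k → H}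
    (hc : c ∈ optimal P k) (j : Fin k) : ‖c j‖ ≤ M := by
  have hp := measureReal_voronoi_pos hP hsupp hc j
  have h := congrArg norm (measureReal_smul_eq_setIntegral_voronoi hP hsupp hc j)
  have h' : ‖∫ x in voronoi k c j, x ∂P‖ ≤ M * P.real (voronoi k c j) :=
    norm_setIntegral_le_of_norm_le_const_ae (measure_lt_top _ _)
      (ae_restrict_of_ae hP.ae_norm_le)
  rw [norm_smul, Real.norm_of_nonneg hp.le] at h
  exact le_of_mul_le_mul_left (by linarith) hp

/-- Comparison of two optimal codebooks through the mass near the skeleton of one of them. -/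
lemma measureReal_voronoi_mul_norm_sub_le {P : Measure H} [IsProbabilityMeasure P] {M : ℝ}
    (hP : MBounded P M) {k : ℕ} (hsupp : SupportMoreThan P k) {a c : Fin k → H}
    (ha : a ∈ optimal P k) (hc : c ∈ optimal P k) {s : ℝ} (hs : 0 < s)
    (hsep : ∀ i j, i ≠ j → s ≤ ‖a i - a j‖) (j : Fin k) :
    P.real (voronoi k a j) * ‖a j - c j‖ ≤
      2 * M * P.real {x | infDist x (Ncrit k a) ≤ 4 * M * dist a c / s} := by
  set E := {x : H | infDist x (Ncrit k a) ≤ 4 * M * dist a c / s}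
  have hEm : MeasurableSet E := measurableSet_le measurable_infDist measurable_const
  set f : H → H := fun x => x - c j with hf
  have hid := integrable_id_of_MBounded hP
  have hfi : Integrable f P := hid.sub (integrable_const _)
  have hint : ∀ d ∈ optimal P k, ∫ x in voronoi k d j, f x ∂P =
      P.real (voronoi k d j) • (d j - c j) := fun d hd => by
    rw [hf, integral_sub hid.integrableOn (integrable_const _),
      ← measureReal_smul_eq_setIntegral_voronoi hP hsupp hd, smul_sub]
    simp
  have hVa := measurableSet_voronoi k a j
  have hVc := measurableSet_voronoi k c j
  have hdiff : P.real (voronoi k a j) • (a j - c j) =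
      ∫ x, ((voronoi k a j).indicator f x - (voronoi k c j).indicator f x) ∂P := by
    rw [integral_sub (hfi.indicator hVa) (hfi.indicator hVc), integral_indicator hVa,
      integral_indicator hVc, hint a ha, hint c hc]
    simp
  have hbound : ‖∫ x, ((voronoi k a j).indicator f x - (voronoi k c j).indicator f x) ∂P‖ ≤
      ∫ x, E.indicator (fun _ => 2 * M) x ∂P := by
    refine norm_integral_le_of_norm_le ((integrable_const _).indicator hEm) ?_
    filter_upwards [hP.ae_norm_le] with x hx
    have hdist : ∀ {d : Fin k → H}, d ∈ optimal P k → ∀ i, ‖x - d i‖ ≤ 2 * M := fun hd i =>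
      (norm_sub_le _ _).trans (by linarith [norm_le_of_optimal hP hsupp hd i])
    have hM : 0 ≤ M := (norm_nonneg x).trans hx
    by_cases h : x ∈ voronoi k a j ↔ x ∈ voronoi k c j
    · have : (voronoi k a j).indicator f x - (voronoi k c j).indicator f x = 0 := by
        simp only [Set.indicator_apply, h, sub_self]
      rw [this, norm_zero]
      exact Set.indicator_nonneg (fun _ _ => by positivity) x
    · have hxE : x ∈ E := by
        have := infDist_Ncrit_le (δ := dist a c) hs hsep (hdist ha)
          (fun i => by rw [← dist_eq_norm]; exact dist_le_pi_dist a c i) h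
        exact this.trans_eq (by ring)
      rw [Set.indicator_of_mem hxE]
      have hfx : ‖f x‖ ≤ 2 * M := hdist hc j
      by_cases hxa : x ∈ voronoi k a j
      · have hxc : x ∉ voronoi k c j := fun hxc => h ⟨fun _ => hxc, fun _ => hxa⟩
        rwa [Set.indicator_of_mem hxa, Set.indicator_of_notMem hxc, sub_zero]
      · have hxc : x ∈ voronoi k c j := by_contra fun hxc =>
          h ⟨fun h => (hxa h).elim, fun h => (hxc h).elim⟩
        rwa [Set.indicator_of_notMem hxa, Set.indicator_of_mem hxc, zero_sub, norm_neg]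
  rw [← hdiff, norm_smul, Real.norm_of_nonneg measureReal_nonneg, integral_indicator hEm] at hbound
  simpa [mul_comm] using hbound

/-- Under the margin condition, optimal codebooks are isolated. -/
lemma eq_of_dist_le_of_margin {P : Measure H} [IsProbabilityMeasure P] {M r₀ : ℝ} (hM : 0 < M)
    {k : ℕ} (hsupp : SupportMoreThan P k) (hmargin : MarginCondition P k M r₀)
    {a c : Fin k → H} (ha : a ∈ optimal P k) (hc : c ∈ optimal P k) {s : ℝ} (hs : 0 < s)
    (hBs : Bsep P k ≤ s) (hsep : ∀ i j, i ≠ j → s ≤ ‖a i - a j‖)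
    (hdist : dist a c ≤ r₀ * s / (4 * M)) : a = c := by
  obtain ⟨-, hP, hmar⟩ := hmargin
  have ht0 : 0 ≤ 4 * M * dist a c / s := by positivity
  have ht1 : 4 * M * dist a c / s ≤ r₀ := by
    rw [le_div_iff₀ (by positivity)] at hdist
    rw [div_le_iff₀ hs]
    linarith
  have hw := (le_pweight ha _).trans (hmar _ ht0 ht1)
  have hpm := pmin_nonneg P k
  have hclose : ∀ j, dist (a j) (c j) ≤ dist a c / 16 := fun j => by
    have hp := measureReal_voronoi_pos hP hsupp ha j
    refine le_of_mul_le_mul_left ?_ hp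
    rw [dist_eq_norm]
    calc P.real (voronoi k a j) * ‖a j - c j‖
        ≤ 2 * M * P.real {x | infDist x (Ncrit k a) ≤ 4 * M * dist a c / s} :=
          measureReal_voronoi_mul_norm_sub_le hP hsupp ha hc hs hsep j
      _ ≤ 2 * M * (Bsep P k * pmin P k * (4 * M * dist a c / s) / (128 * M ^ 2)) := by gcongr
      _ ≤ 2 * M * (s * P.real (voronoi k a j) * (4 * M * dist a c / s) / (128 * M ^ 2)) := by
          gcongr
          exact pmin_le ha j
      _ = P.real (voronoi k a j) * (dist a c / 16) := by field_simp; ring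
  have := (dist_pi_le_iff (by positivity)).2 hclose
  exact dist_le_zero.1 (by linarith)

/-- The set of partial means of a bounded law on a separable Hilbert space is totally bounded. -/
lemma totallyBounded_setIntegral_id {P : Measure H} [IsProbabilityMeasure P] {M : ℝ} (hM : 0 < M)
    (hP : MBounded P M) :
    TotallyBounded {z : H | ∃ A, MeasurableSet A ∧ z = ∫ x in A, x ∂P} := by
  rw [Metric.totallyBounded_iff]
  intro ε hε
  obtain ⟨K, -, hK, hKlt⟩ := (MeasurableSet.univ (α := H)).exists_isCompact_sdiff_lt
    (measure_ne_top P _) (ε := ENNReal.ofReal (ε / (4 * M))) (by simp; positivity)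
  have hKm := hK.measurableSet
  have hid := integrable_id_of_MBounded hP
  have hC : TotallyBounded (closure (convexHull ℝ (insert 0 K))) :=
    (totallyBounded_convexHull.2 (hK.insert 0).totallyBounded).closure
  obtain ⟨t, ht, hcover⟩ := Metric.totallyBounded_iff.1 hC (ε / 2) (half_pos hε)
  refine ⟨t, ht, ?_⟩
  rintro _ ⟨A, hA, rfl⟩
  have hmem : ∫ x in A ∩ K, x ∂P ∈ closure (convexHull ℝ (insert 0 K)) := by
    rw [← integral_indicator (hA.inter hKm)]
    refine (convex_convexHull ℝ _).closure.integral_mem isClosed_closure (.of_forall fun x => ?_)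
      (hid.indicator (hA.inter hKm))
    refine subset_closure (subset_convexHull ℝ _ ?_)
    by_cases hx : x ∈ A ∩ K
    · rw [Set.indicator_of_mem hx]; exact Set.mem_insert_of_mem _ hx.2
    · rw [Set.indicator_of_notMem hx]; exact Set.mem_insert _ _
  obtain ⟨y, hy, hlt⟩ := Set.mem_iUnion₂.1 (hcover hmem)
  refine Set.mem_iUnion₂.2 ⟨y, hy, ?_⟩
  rw [mem_ball] at hlt ⊢
  have hsmall : dist (∫ x in A, x ∂P) (∫ x in A ∩ K, x ∂P) ≤ ε / 4 := by
    rw [dist_eq_norm, ← integral_inter_add_sdiff hKm hid.integrableOn, add_sub_cancel_left]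
    have h1 : ‖∫ x in A \ K, x ∂P‖ ≤ M * P.real (A \ K) :=
      norm_setIntegral_le_of_norm_le_const_ae (measure_lt_top _ _)
        (ae_restrict_of_ae hP.ae_norm_le)
    have h2 : P.real (A \ K) ≤ ε / (4 * M) :=
      ENNReal.toReal_le_of_le_ofReal (by positivity)
        ((measure_mono (Set.sdiff_subset_sdiff_left (Set.subset_univ A))).trans hKlt.le)
    calc _ ≤ M * P.real (A \ K) := h1
      _ ≤ M * (ε / (4 * M)) := by gcongr
      _ = ε / 4 := by field_simp
  calc _ ≤ _ := dist_triangle _ (∫ x in A ∩ K, x ∂P) _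
    _ < ε := by linarith

end Distortion

lemma TotallyBounded.finite_of_separated {X : Type*} [MetricSpace X] {S : Set X}
    (hS : TotallyBounded S) {δ : ℝ} (hδ : 0 < δ)
    (hsep : ∀ a ∈ S, ∀ b ∈ S, dist a b ≤ δ → a = b) : S.Finite := by
  obtain ⟨t, ht, hcover⟩ := Metric.totallyBounded_iff.1 hS (δ / 2) (half_pos hδ)
  refine (ht.biUnion fun y _ => Set.Subsingleton.finite (s := S ∩ ball y (δ / 2)) ?_).subset
    fun x hx => ?_
  · rintro a ⟨ha, hay⟩ b ⟨hb, hby⟩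
    rw [mem_ball] at hay hby
    exact hsep a ha b hb (by linarith [dist_triangle_right a b y])
  · obtain ⟨y, hy, hxy⟩ := Set.mem_iUnion₂.1 (hcover hx)
    exact Set.mem_iUnion₂.2 ⟨y, hy, hx, hxy⟩

variable {H : Type*} [NormedAddCommGroup H] [InnerProductSpace ℝ H]
  [MeasurableSpace H] [BorelSpace H] [SecondCountableTopology H] [CompleteSpace H]

/-- under the margin condition, the orbit of an optimal codebook
under the isometry group of `P` is finite. -/
theorem orbit_of_optimal_finite_of_margin
    (P : Measure H) [IsProbabilityMeasure P] (k : ℕ) (M r₀ : ℝ)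
    (hk : 1 ≤ k) (hM : 0 < M) (hsupp : SupportMoreThan P k)
    (hmargin : MarginCondition P k M r₀) :
    ∀ cs ∈ optimal P k,
      {c : Fin k → H | ∃ T : H → H, Isometry T ∧ P.map T = P ∧ c = T ∘ cs}.Finite := by
  intro cs hcs
  have hP := hmargin.2.1
  obtain ⟨s, hs, hBs, hsep⟩ : ∃ s : ℝ, 0 < s ∧ Bsep P k ≤ s ∧
      ∀ i j, i ≠ j → s ≤ ‖cs i - cs j‖ := by
    rcases isEmpty_or_nonempty {p : Fin k × Fin k // p.1 ≠ p.2} with h | h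
    · exact ⟨max 1 (Bsep P k), by positivity, le_max_right _ _,
        fun i j hij => (h.false ⟨(i, j), hij⟩).elim⟩
    · obtain ⟨⟨⟨i, j⟩, hij⟩, hmin⟩ :=
        Finite.exists_min fun p : {p : Fin k × Fin k // p.1 ≠ p.2} => ‖cs p.1.1 - cs p.1.2‖
      exact ⟨‖cs i - cs j‖,
        norm_pos_iff.2 (sub_ne_zero.2 ((injective_of_optimal hP hsupp hcs).ne hij)),
        Bsep_le hcs hij, fun i' j' h' => hmin ⟨(i', j'), h'⟩⟩
  have hδ : 0 < r₀ * s / (4 * M) := by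
    have := hmargin.1
    positivity
  refine TotallyBounded.finite_of_separated ?_ hδ ?_
  · set Z := closure {z : H | ∃ A, MeasurableSet A ∧ z = ∫ x in A, x ∂P}
    have hZc : IsCompact Z :=
      (totallyBounded_setIntegral_id hM hP).closure.isCompact_of_isClosed isClosed_closure
    have hcont : Continuous fun (z : Fin k → H) (j : Fin k) =>
        (P.real (voronoi k cs j))⁻¹ • z j := by fun_prop
    refine ((isCompact_univ_pi fun _ : Fin k => hZc).image hcont).totallyBounded.subset ?_
    rintro _ ⟨T, hT, hTP, rfl⟩
    refine ⟨fun j => ∫ x in voronoi k (T ∘ cs) j, x ∂P, fun j _ =>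
      subset_closure ⟨_, measurableSet_voronoi _ _ _, rfl⟩, funext fun j => ?_⟩
    have hmass : P.real (voronoi k (T ∘ cs) j) = P.real (voronoi k cs j) := by
      conv_lhs => rw [← hTP]
      rw [map_measureReal_apply hT.continuous.measurable (measurableSet_voronoi _ _ _),
        isometry_preimage_voronoi hT]
    beta_reduce
    rw [← measureReal_smul_eq_setIntegral_voronoi hP hsupp (optimal_comp_isometry hcs hT hTP),
      hmass, inv_smul_smul₀ (measureReal_voronoi_pos hP hsupp hcs j).ne']
  · rintro _ ⟨T, hT, hTP, rfl⟩ _ ⟨U, hU, hUP, rfl⟩ hd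
    refine eq_of_dist_le_of_margin hM hsupp hmargin (optimal_comp_isometry hcs hT hTP)
      (optimal_comp_isometry hcs hU hUP) hs hBs (fun i j hij => ?_) hd
    simpa [← dist_eq_norm, hT.dist_eq] using hsep i j hij
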